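/- arXiv:1509.00092 — 4 statements merged into one kernel-verified Lean document; each statement's English description precedes it below -/
import Mathlib

section
/- For every constant K ≥ 1 there exist constants C ≥ 1 and c > 0 (depending only on K) such that the following holds. Let n = v·w with v ≤ K·w·2^w, and let 𝒫 = {P^1,…,P^u} be a collection of partitions of [n] into v blocks of size w that is a (d,k,δ)-design with d ≤ k ≤ w. For x uniform on {0,1}^n put Z_α = T_{P^α}(x) for α ∈ [u]. Then for every integer 1 ≤ a ≤ d, C(u,a)·(1 − 2^{−w})^{v·a} ≤ E[ S_a(1−Z_1, 1−Z_2, …, 1−Z_u) ] ≤ γ · C(u,a) · (1 − 2^{−w})^{v·a}, where γ = exp( C·w·d·2^{−c·k} ) + 2^{C·w}·δ and C(u,a) is the binomial coefficient. -/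
open Finset

/-- Probability of event `E` under the uniform distribution on a finite type. -/
noncomputable def uPr {α : Type*} [Fintype α] (E : α → Prop) : ℝ :=
  (Nat.card {x // E x} : ℝ) / (Fintype.card α)

-- The real-valued indicator of the Tribes event `T_P(x) = 1`.
open Classical in
noncomputable def tribeInd {n v : ℕ} (P : Fin v → Finset (Fin n)) (x : Fin n → Bool) : ℝ :=
  if ∃ j, ∀ k ∈ P j, x k = true then 1 else 0

/-- The real-valued indicator that all coordinates of `x` in `S` are `true`. -/
def termInd {n : ℕ} (S : Finset (Fin n)) (x : Fin n → Bool) : ℝ :=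
  ∏ k ∈ S, if x k = true then 1 else 0

/-- The real-valued indicator that none of the terms `A i`, `i ∈ T`, is satisfied by `x`. -/
def noTerm {ι : Type*} {n : ℕ} (A : ι → Finset (Fin n)) (T : Finset ι) (x : Fin n → Bool) : ℝ :=
  ∏ i ∈ T, (1 - termInd (A i) x)

/-- Expectation under the uniform distribution on the Boolean cube. -/
noncomputable def cubeExp {n : ℕ} (f : (Fin n → Bool) → ℝ) : ℝ :=
  (∑ x, f x) / 2 ^ n

section Expectation

variable {n : ℕ} (f g : (Fin n → Bool) → ℝ)

lemma cubeExp_sub : cubeExp (fun x => f x - g x) = cubeExp f - cubeExp g := by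
  simp [cubeExp, Finset.sum_sub_distrib, sub_div]

lemma cubeExp_sum {ι : Type*} (s : Finset ι) (h : ι → (Fin n → Bool) → ℝ) :
    cubeExp (fun x => ∑ i ∈ s, h i x) = ∑ i ∈ s, cubeExp (h i) := by
  simp only [cubeExp]
  rw [Finset.sum_comm, Finset.sum_div]

lemma cubeExp_one : cubeExp (fun _ : Fin n → Bool => 1) = 1 := by
  simp [cubeExp]

variable {f g}

lemma cubeExp_mono (h : ∀ x, f x ≤ g x) : cubeExp f ≤ cubeExp g := by
  unfold cubeExp
  gcongr with x
  exact h x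

lemma cubeExp_nonneg (h : ∀ x, 0 ≤ f x) : 0 ≤ cubeExp f :=
  div_nonneg (Finset.sum_nonneg fun x _ => h x) (by positivity)

lemma cubeExp_mul_le_of_monotone_of_antitone (hf₀ : ∀ x, 0 ≤ f x) (hf : Monotone f)
    (hg₁ : ∀ x, g x ≤ 1) (hg : Antitone g) :
    cubeExp (fun x => f x * g x) ≤ cubeExp f * cubeExp g := by
  have h := fkg (α := Fin n → Bool) (μ := fun _ => (1 : ℝ)) (f := f) (g := fun x => 1 - g x)
    (fun _ => zero_le_one) (fun x => hf₀ x) (fun x => sub_nonneg.2 (hg₁ x)) hf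
    (fun x y hxy => sub_le_sub_left (hg hxy) 1) (fun _ _ => le_rfl)
  simp only [one_mul, mul_sub, mul_one, Finset.sum_sub_distrib, Finset.sum_const,
    Finset.card_univ, Fintype.card_pi, Fintype.card_bool, Finset.prod_const, Fintype.card_fin,
    nsmul_eq_mul, Nat.cast_pow, Nat.cast_ofNat] at h
  unfold cubeExp
  rw [div_mul_div_comm, div_le_div_iff₀ (by positivity) (by positivity)]
  have h2 : (0 : ℝ) < 2 ^ n := by positivity
  nlinarith

end Expectation

section Terms

variable {n : ℕ} {ι : Type*}

lemma termInd_eq_ite (S : Finset (Fin n)) (x : Fin n → Bool) :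
    termInd S x = if ∀ k ∈ S, x k = true then 1 else 0 := by
  simp [termInd, Finset.prod_ite_zero]

lemma termInd_nonneg (S : Finset (Fin n)) (x : Fin n → Bool) : 0 ≤ termInd S x := by
  rw [termInd_eq_ite]; split_ifs <;> norm_num

lemma termInd_le_one (S : Finset (Fin n)) (x : Fin n → Bool) : termInd S x ≤ 1 := by
  rw [termInd_eq_ite]; split_ifs <;> norm_num

lemma termInd_monotone (S : Finset (Fin n)) : Monotone (termInd S) := by
  intro x y hxy
  simp only [termInd_eq_ite]
  split_ifs with hx hy
  · exact le_rfl
  · exact absurd (fun k hk => hxy k (hx k hk)) hy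
  · exact zero_le_one
  · exact le_rfl

lemma termInd_mul (S T : Finset (Fin n)) (x : Fin n → Bool) :
    termInd S x * termInd T x = termInd (S ∪ T) x := by
  simp only [termInd_eq_ite, Finset.mem_union]
  split_ifs <;> grind

lemma cubeExp_noTerm_empty (A : ι → Finset (Fin n)) : cubeExp (noTerm A ∅) = 1 :=
  cubeExp_one

lemma noTerm_nonneg (A : ι → Finset (Fin n)) (T : Finset ι) (x : Fin n → Bool) :
    0 ≤ noTerm A T x :=
  Finset.prod_nonneg fun _ _ => sub_nonneg.2 (termInd_le_one _ _)

lemma noTerm_le_one (A : ι → Finset (Fin n)) (T : Finset ι) (x : Fin n → Bool) :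
    noTerm A T x ≤ 1 :=
  Finset.prod_le_one (fun _ _ => sub_nonneg.2 (termInd_le_one _ _))
    fun _ _ => sub_le_self _ (termInd_nonneg _ _)

lemma noTerm_antitone (A : ι → Finset (Fin n)) (T : Finset ι) : Antitone (noTerm A T) :=
  fun _ _ hxy => Finset.prod_le_prod (fun _ _ => sub_nonneg.2 (termInd_le_one _ _))
    fun _ _ => sub_le_sub_left (termInd_monotone _ hxy) 1

lemma one_sub_sum_le_noTerm (A : ι → Finset (Fin n)) (T : Finset ι) (x : Fin n → Bool) :
    1 - ∑ i ∈ T, termInd (A i) x ≤ noTerm A T x := by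
  classical
  induction T using Finset.induction_on with
  | empty => simp [noTerm]
  | insert i T hi ih =>
    have h1 := noTerm_le_one A T x
    have h2 := termInd_nonneg (A i) x
    rw [noTerm, Finset.prod_insert hi, Finset.sum_insert hi, ← noTerm]
    nlinarith

lemma sum_coord_mul (k : Fin n) (h : (Fin n → Bool) → ℝ)
    (hh : ∀ x b, h (Function.update x k b) = h x) :
    2 * ∑ x, (if x k = true then 1 else 0) * h x = ∑ x, h x := by
  have hinv : Function.Involutive
      (fun x : Fin n → Bool => Function.update x k (!x k)) := by
    intro x; simp
  have hflip : ∑ x : Fin n → Bool, (if x k = true then (1 : ℝ) else 0) * h x =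
      ∑ x : Fin n → Bool, (if x k = true then (0 : ℝ) else 1) * h x := by
    refine Fintype.sum_equiv hinv.toPerm _ _ fun x => ?_
    simp only [Function.Involutive.coe_toPerm, Function.update_self, hh]
    cases x k <;> simp
  rw [two_mul]
  nth_rewrite 2 [hflip]
  rw [← Finset.sum_add_distrib]
  refine Finset.sum_congr rfl fun x _ => ?_
  split_ifs <;> ring

lemma cubeExp_termInd_mul (S : Finset (Fin n)) (h : (Fin n → Bool) → ℝ)
    (hh : ∀ k ∈ S, ∀ x b, h (Function.update x k b) = h x) :
    cubeExp (fun x => termInd S x * h x) = (1 / 2) ^ S.card * cubeExp h := by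
  induction S using Finset.induction_on with
  | empty => simp [termInd]
  | insert k S hk ih =>
    have ih := ih fun l hl => hh l (Finset.mem_insert_of_mem hl)
    have key := sum_coord_mul k (fun x => termInd S x * h x) (by
      intro x b
      simp only [hh k (Finset.mem_insert_self k S)]
      congr 1
      refine Finset.prod_congr rfl fun l hl => ?_
      rw [Function.update_of_ne (ne_of_mem_of_not_mem hl hk)])
    rw [Finset.card_insert_of_notMem hk, pow_succ, mul_right_comm, ← ih]
    unfold cubeExp
    rw [← key]
    simp only [termInd, Finset.prod_insert hk, mul_assoc]
    ring

lemma cubeExp_termInd (S : Finset (Fin n)) : cubeExp (termInd S) = (1 / 2) ^ S.card := by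
  simpa [cubeExp_one] using cubeExp_termInd_mul S (fun _ => 1) (fun _ _ _ _ => rfl)

lemma cubeExp_termInd_mul_noTerm_le (A : ι → Finset (Fin n)) (S : Finset (Fin n))
    (T : Finset ι) :
    cubeExp (fun x => termInd S x * noTerm A T x) ≤ (1 / 2) ^ S.card * cubeExp (noTerm A T) := by
  rw [← cubeExp_termInd]
  exact cubeExp_mul_le_of_monotone_of_antitone (termInd_nonneg S) (termInd_monotone S)
    (noTerm_le_one A T) (noTerm_antitone A T)

lemma cubeExp_noTerm_insert [DecidableEq ι] (A : ι → Finset (Fin n)) {i : ι} {T : Finset ι}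
    (hi : i ∉ T) :
    cubeExp (noTerm A (insert i T)) =
      cubeExp (noTerm A T) - cubeExp (fun x => termInd (A i) x * noTerm A T x) := by
  rw [← cubeExp_sub]
  congr 1
  ext x
  rw [noTerm, Finset.prod_insert hi, ← noTerm]
  ring

lemma pow_card_le_cubeExp_noTerm (A : ι → Finset (Fin n)) (T : Finset ι) {w : ℕ}
    (hA : ∀ i ∈ T, (A i).card = w) :
    (1 - (1 / 2 : ℝ) ^ w) ^ T.card ≤ cubeExp (noTerm A T) := by
  classical
  induction T using Finset.induction_on with
  | empty => simp [cubeExp_noTerm_empty]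
  | insert i T hi ih =>
    have ih := ih fun j hj => hA j (Finset.mem_insert_of_mem hj)
    have h1 := cubeExp_termInd_mul_noTerm_le A (A i) T
    rw [hA i (Finset.mem_insert_self i T)] at h1
    have hp : (0 : ℝ) ≤ 1 - (1 / 2) ^ w :=
      sub_nonneg.2 (pow_le_one₀ (by norm_num) (by norm_num))
    rw [cubeExp_noTerm_insert A hi, Finset.card_insert_of_notMem hi, pow_succ]
    nlinarith [mul_le_mul_of_nonneg_right ih hp]

/-- The total correlation of the pairs of distinct intersecting terms. -/
noncomputable def correlation [DecidableEq ι] (A : ι → Finset (Fin n)) (T : Finset ι) : ℝ :=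
  ∑ i ∈ T, ∑ j ∈ T, if i ≠ j ∧ ¬ Disjoint (A i) (A j) then (1 / 2 : ℝ) ^ (A i ∪ A j).card else 0

lemma cubeExp_noTerm_insert_le [DecidableEq ι] (A : ι → Finset (Fin n)) {i : ι} {T : Finset ι}
    (hi : i ∉ T) :
    cubeExp (noTerm A (insert i T)) ≤ cubeExp (noTerm A T) * (1 - (1 / 2) ^ (A i).card +
      ∑ j ∈ T, if i ≠ j ∧ ¬ Disjoint (A i) (A j) then (1 / 2 : ℝ) ^ (A i ∪ A j).card else 0) := by
  set D := T.filter fun j => ¬ Disjoint (A i) (A j)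
  set D' := T.filter fun j => Disjoint (A i) (A j)
  have hsum : (∑ j ∈ T, if i ≠ j ∧ ¬ Disjoint (A i) (A j) then
      (1 / 2 : ℝ) ^ (A i ∪ A j).card else 0) = ∑ j ∈ D, (1 / 2 : ℝ) ^ (A i ∪ A j).card := by
    rw [Finset.sum_filter]
    refine Finset.sum_congr rfl fun j hj => ?_
    simp [(ne_of_mem_of_not_mem hj hi).symm]
  have hsplit : ∀ x, noTerm A T x = noTerm A D' x * noTerm A D x := fun x =>
    (Finset.prod_filter_mul_prod_filter_not T _ _).symm
  have hindep : cubeExp (fun x => termInd (A i) x * noTerm A D' x) =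
      (1 / 2) ^ (A i).card * cubeExp (noTerm A D') := by
    refine cubeExp_termInd_mul _ _ fun k hk x b => ?_
    refine Finset.prod_congr rfl fun j hj => ?_
    congr 1
    refine Finset.prod_congr rfl fun l hl => ?_
    rw [Function.update_of_ne]
    rintro rfl
    exact Finset.disjoint_left.1 (Finset.mem_filter.1 hj).2 hk hl
  have hpoint : cubeExp (fun x => termInd (A i) x * noTerm A D' x -
      ∑ j ∈ D, termInd (A i ∪ A j) x * noTerm A D' x) ≤
      cubeExp (fun x => termInd (A i) x * noTerm A T x) := by
    refine cubeExp_mono fun x => ?_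
    simp only [hsplit, ← termInd_mul]
    have h1 := one_sub_sum_le_noTerm A D x
    have h2 := mul_le_mul_of_nonneg_left h1
      (mul_nonneg (termInd_nonneg (A i) x) (noTerm_nonneg A D' x))
    calc _ = termInd (A i) x * noTerm A D' x * (1 - ∑ j ∈ D, termInd (A j) x) := by
          rw [mul_sub, mul_one, Finset.mul_sum]
          congr 1
          exact Finset.sum_congr rfl fun j _ => by ring
      _ ≤ _ := h2
      _ = _ := by ring
  rw [cubeExp_sub, cubeExp_sum, hindep] at hpoint
  have hcorr : ∑ j ∈ D, cubeExp (fun x => termInd (A i ∪ A j) x * noTerm A D' x) ≤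
      (∑ j ∈ D, (1 / 2 : ℝ) ^ (A i ∪ A j).card) * cubeExp (noTerm A D') := by
    rw [Finset.sum_mul]
    exact Finset.sum_le_sum fun j _ => cubeExp_termInd_mul_noTerm_le _ _ _
  have hmono : cubeExp (noTerm A T) ≤ cubeExp (noTerm A D') := by
    refine cubeExp_mono fun x => ?_
    rw [hsplit]
    exact mul_le_of_le_one_right (noTerm_nonneg A D' x) (noTerm_le_one A D x)
  have h0 : 0 ≤ cubeExp (fun x => termInd (A i) x * noTerm A T x) :=
    cubeExp_nonneg fun x => mul_nonneg (termInd_nonneg _ _) (noTerm_nonneg _ _ _)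
  have hT0 : 0 ≤ cubeExp (noTerm A T) := cubeExp_nonneg (noTerm_nonneg A T)
  rw [hsum, cubeExp_noTerm_insert A hi]
  set s := ∑ j ∈ D, (1 / 2 : ℝ) ^ (A i ∪ A j).card
  set p := (1 / 2 : ℝ) ^ (A i).card
  rcases le_total s p with h | h
  · nlinarith [mul_le_mul_of_nonneg_right hmono (sub_nonneg.2 h)]
  · nlinarith [mul_nonneg hT0 (sub_nonneg.2 h)]

/-- Janson's inequality for terms of equal width. -/
lemma cubeExp_noTerm_le [DecidableEq ι] (A : ι → Finset (Fin n)) (T : Finset ι) {w : ℕ}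
    (hw : 0 < w) (hA : ∀ i ∈ T, (A i).card = w) :
    cubeExp (noTerm A T) ≤
      (1 - (1 / 2 : ℝ) ^ w) ^ T.card * Real.exp (2 * correlation A T) := by
  induction T using Finset.induction_on with
  | empty => simp [cubeExp_noTerm_empty, correlation]
  | insert i T hi ih =>
    have ih := ih fun j hj => hA j (Finset.mem_insert_of_mem hj)
    have hstep := cubeExp_noTerm_insert_le A hi
    rw [hA i (Finset.mem_insert_self i T)] at hstep
    set r := ∑ j ∈ T, if i ≠ j ∧ ¬ Disjoint (A i) (A j) then
      (1 / 2 : ℝ) ^ (A i ∪ A j).card else 0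
    have hr : 0 ≤ r := Finset.sum_nonneg fun j _ => by split_ifs <;> positivity
    have hp : (1 / 2 : ℝ) ^ w ≤ 1 / 2 := by
      simpa using pow_le_pow_of_le_one (by norm_num : (0 : ℝ) ≤ 1 / 2) (by norm_num) hw
    have hcorr : correlation A T + r ≤ correlation A (insert i T) := by
      unfold correlation
      rw [Finset.sum_insert hi, Finset.sum_insert hi, add_comm]
      have : 0 ≤ if i ≠ i ∧ ¬ Disjoint (A i) (A i) then
        (1 / 2 : ℝ) ^ (A i ∪ A i).card else 0 := by simp
      refine add_le_add (by linarith) (Finset.sum_le_sum fun j _ => ?_)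
      rw [Finset.sum_insert hi]
      refine le_add_of_nonneg_left ?_
      split_ifs <;> positivity
    have hfac : 1 - (1 / 2 : ℝ) ^ w + r ≤ (1 - (1 / 2 : ℝ) ^ w) * Real.exp (2 * r) := by
      nlinarith [Real.add_one_le_exp (2 * r)]
    calc cubeExp (noTerm A (insert i T)) ≤ _ := hstep
      _ ≤ ((1 - (1 / 2 : ℝ) ^ w) ^ T.card * Real.exp (2 * correlation A T)) *
          ((1 - (1 / 2 : ℝ) ^ w) * Real.exp (2 * r)) :=
        mul_le_mul ih hfac (by linarith)
          (mul_nonneg (pow_nonneg (by linarith) _) (Real.exp_nonneg _))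
      _ = (1 - (1 / 2 : ℝ) ^ w) ^ (T.card + 1) *
          Real.exp (2 * (correlation A T + r)) := by
        rw [mul_add, Real.exp_add]; ring
      _ ≤ _ := by
        rw [Finset.card_insert_of_notMem hi]
        have : (0 : ℝ) ≤ 1 - (1 / 2) ^ w := by linarith
        gcongr

end Terms

section Designs

/-- Contribution of one term `A` against the blocks of a partition which meet it only slightly. -/
lemma sum_pow_card_union_le {n v w t : ℕ} (hw : 0 < w) (ht : t ≤ w) (A : Finset (Fin n))
    (hA : A.card = w) (P : Fin v → Finset (Fin n)) (hP : ∀ j, (P j).card = w)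
    (hdisj : ∀ i j, i ≠ j → Disjoint (P i) (P j))
    (hint : ∀ j, (A ∩ P j).card ≤ w - t) :
    (∑ j, if ¬ Disjoint A (P j) then (1 / 2 : ℝ) ^ (A ∪ P j).card else 0) ≤
      (t + 1) * (1 / 2) ^ (w + t) := by
  have hterm : ∀ j, (w : ℝ) * (if ¬ Disjoint A (P j) then (1 / 2 : ℝ) ^ (A ∪ P j).card else 0) ≤
      ((t + 1) * (1 / 2) ^ (w + t)) * ((A ∩ P j).card : ℝ) := by
    intro j
    split_ifs with h
    · rw [mul_zero]; positivity
    · have hm : 0 < (A ∩ P j).card := by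
        rw [Finset.card_pos, ← Finset.not_disjoint_iff_nonempty_inter]
        exact h
      have hcard := Finset.card_union_add_card_inter A (P j)
      rw [hA, hP j] at hcard
      obtain ⟨r, hr⟩ := Nat.exists_eq_add_of_le (hint j)
      set m := (A ∩ P j).card
      have hu : (A ∪ P j).card = w + t + r := by omega
      have hwt : w = t + (m + r) := by omega
      have hr2 : (r : ℝ) + 1 ≤ 2 ^ r := by exact_mod_cast Nat.lt_two_pow_self (n := r)
      have hm1 : (1 : ℝ) ≤ m := by exact_mod_cast hm
      have hkey : (w : ℝ) ≤ (t + 1) * m * 2 ^ r := by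
        have h1 : (w : ℝ) ≤ (t + 1) * (m + r) := by
          rw [hwt]
          push_cast
          nlinarith [mul_nonneg (Nat.cast_nonneg (α := ℝ) t)
            (add_nonneg (sub_nonneg.2 hm1) (Nat.cast_nonneg (α := ℝ) r))]
        have h2 : (m : ℝ) + r ≤ m * 2 ^ r := by
          nlinarith [mul_nonneg (sub_nonneg.2 hm1) (Nat.cast_nonneg (α := ℝ) r)]
        nlinarith [mul_le_mul_of_nonneg_left h2 (by positivity : (0 : ℝ) ≤ t + 1)]
      have h21 : (2 : ℝ) ^ r * (1 / 2) ^ r = 1 := by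
        rw [← mul_pow]; norm_num
      rw [hu, pow_add]
      calc (w : ℝ) * ((1 / 2) ^ (w + t) * (1 / 2) ^ r)
          ≤ ((t + 1) * m * 2 ^ r) * ((1 / 2) ^ (w + t) * (1 / 2) ^ r) := by gcongr
        _ = ((t + 1) * (1 / 2) ^ (w + t)) * m * (2 ^ r * (1 / 2) ^ r) := by ring
        _ = _ := by rw [h21, mul_one]
  have hsum : ∑ j, (A ∩ P j).card ≤ w := by
    rw [← hA, ← Finset.card_biUnion]
    · exact Finset.card_le_card (Finset.biUnion_subset.2 fun _ _ => Finset.inter_subset_left)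
    · exact fun i _ j _ hij => (hdisj i j hij).mono Finset.inter_subset_right
        Finset.inter_subset_right
  have hw' : (0 : ℝ) < w := by exact_mod_cast hw
  refine le_of_mul_le_mul_left ?_ hw'
  rw [Finset.mul_sum]
  calc _ ≤ ∑ j, ((t + 1) * (1 / 2) ^ (w + t)) * ((A ∩ P j).card : ℝ) :=
        Finset.sum_le_sum fun j _ => hterm j
    _ = ((t + 1) * (1 / 2) ^ (w + t)) * ((∑ j, (A ∩ P j).card : ℕ) : ℝ) := by
        rw [← Finset.mul_sum]; push_cast; rfl
    _ ≤ ((t + 1) * (1 / 2) ^ (w + t)) * w := by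
        have : ((∑ j, (A ∩ P j).card : ℕ) : ℝ) ≤ w := by exact_mod_cast hsum
        gcongr
    _ = _ := by ring

lemma correlation_product_le {n u v w t : ℕ} (hw : 0 < w) (ht : t ≤ w)
    (P : Fin u → Fin v → Finset (Fin n)) (hP : ∀ α j, (P α j).card = w)
    (hdisj : ∀ α, ∀ i j, i ≠ j → Disjoint (P α i) (P α j)) (I : Finset (Fin u))
    (hint : ∀ α ∈ I, ∀ β ∈ I, α ≠ β → ∀ i j, (P α i ∩ P β j).card ≤ w - t) :
    correlation (fun p : Fin u × Fin v => P p.1 p.2) (I ×ˢ Finset.univ) ≤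
      I.card ^ 2 * v * ((t + 1) * (1 / 2) ^ (w + t)) := by
  unfold correlation
  calc _ = ∑ α ∈ I, ∑ i, ∑ β ∈ I, ∑ j, if (α, i) ≠ (β, j) ∧ ¬ Disjoint (P α i) (P β j) then
        (1 / 2 : ℝ) ^ (P α i ∪ P β j).card else 0 := by
        simp only [Finset.sum_product]
    _ ≤ ∑ α ∈ I, ∑ i : Fin v, ∑ β ∈ I, ((t + 1) * (1 / 2 : ℝ) ^ (w + t)) := by
        refine Finset.sum_le_sum fun α hα => Finset.sum_le_sum fun i _ =>
          Finset.sum_le_sum fun β hβ => ?_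
        by_cases hαβ : α = β
        · subst hαβ
          rw [Finset.sum_eq_zero]
          · positivity
          · intro j _
            rw [if_neg]
            rintro ⟨h1, h2⟩
            exact h2 (hdisj α i j fun h => h1 (by rw [h]))
        · simpa [hαβ] using sum_pow_card_union_le hw ht (P α i) (hP α i) (P β) (hP β) (hdisj β)
            (hint α hα β hβ hαβ i)
    _ = _ := by
        simp only [Finset.sum_const, Finset.card_univ, Fintype.card_fin, nsmul_eq_mul]
        ring

lemma card_filter_pair_mem_le {u a : ℕ} {α β : Fin u} (h : α ≠ β) :
    (((Finset.powersetCard a (Finset.univ : Finset (Fin u))).filter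
      fun I => α ∈ I ∧ β ∈ I).card : ℝ) * u ^ 2 ≤ 2 * a ^ 2 * u.choose a := by
  obtain ⟨u, rfl⟩ : ∃ u', u = u' + 2 := by
    refine Nat.exists_eq_add_of_le' ?_
    by_contra hu
    exact h (Fin.ext (by omega))
  set F := (Finset.powersetCard a (Finset.univ : Finset (Fin (u + 2)))).filter
    fun I => α ∈ I ∧ β ∈ I
  rcases F.eq_empty_or_nonempty with hF | ⟨I, hI⟩
  · rw [hF]; simp; positivity
  obtain ⟨a, rfl⟩ : ∃ a', a = a' + 2 := by
    refine Nat.exists_eq_add_of_le' ?_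
    simp only [F, Finset.mem_filter, Finset.mem_powersetCard] at hI
    rw [← hI.1.2]
    exact Finset.one_lt_card.2 ⟨α, hI.2.1, β, hI.2.2, h⟩
  have hF : F.card ≤ u.choose a := by
    have hc : ((Finset.univ.erase α).erase β : Finset (Fin (u + 2))).card = u := by
      rw [Finset.card_erase_of_mem (by simp [h.symm]), Finset.card_erase_of_mem (by simp)]
      simp
    have hc' : ((((Finset.univ : Finset (Fin (u + 2))).erase α).erase β).powersetCard a).card =
        u.choose a := by
      rw [Finset.card_powersetCard, hc]
    rw [← hc']
    refine Finset.card_le_card_of_injOn (fun I => (I.erase α).erase β) ?_ ?_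
    · intro I hI
      simp only [F, Finset.coe_filter, Finset.mem_powersetCard, Set.mem_ofPred_eq] at hI
      simp only [Finset.mem_coe, Finset.mem_powersetCard]
      refine ⟨Finset.erase_subset_erase _ (Finset.erase_subset_erase _ (Finset.subset_univ _)), ?_⟩
      rw [Finset.card_erase_of_mem (by simp [h.symm, hI.2.2]),
        Finset.card_erase_of_mem hI.2.1, hI.1.2]
      rfl
    · intro I hI J hJ hIJ
      simp only [F, Finset.coe_filter, Finset.mem_powersetCard, Set.mem_ofPred_eq] at hI hJ
      ext x
      have := congrArg (x ∈ ·) hIJ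
      simp only [Finset.mem_erase] at this
      grind
  have h1 : ((u : ℝ) + 1) * u.choose a = (u + 1).choose (a + 1) * (a + 1) := by
    exact_mod_cast Nat.add_one_mul_choose_eq u a
  have h2 : ((u : ℝ) + 2) * (u + 1).choose (a + 1) = (u + 2).choose (a + 2) * (a + 2) := by
    exact_mod_cast Nat.add_one_mul_choose_eq (u + 1) (a + 1)
  have hF' : (F.card : ℝ) ≤ u.choose a := by exact_mod_cast hF
  push_cast
  calc (F.card : ℝ) * (u + 2) ^ 2 ≤ u.choose a * (2 * ((u + 1) * (u + 2))) := by
        gcongr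
        nlinarith [Nat.cast_nonneg (α := ℝ) u]
    _ = 2 * ((a + 1) * (a + 2)) * (u + 2).choose (a + 2) := by
        linear_combination 2 * ((u : ℝ) + 2) * h1 + 2 * ((a : ℝ) + 1) * h2
    _ ≤ 2 * (a + 2) ^ 2 * (u + 2).choose (a + 2) := by
        gcongr
        nlinarith [Nat.cast_nonneg (α := ℝ) a]

lemma card_filter_not_le_of_uPr {u : ℕ} {δ : ℝ} (hu : 0 < u) (E : Fin u → Prop)
    [DecidablePred E] (h : 1 - δ ≤ uPr E) :
    ((Finset.univ.filter fun β => ¬ E β).card : ℝ) ≤ δ * u := by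
  have hu' : (0 : ℝ) < u := by exact_mod_cast hu
  rw [uPr, Nat.card_eq_fintype_card, Fintype.card_subtype, Fintype.card_fin,
    le_div_iff₀ hu'] at h
  have hs := Finset.card_filter_add_card_filter_not (s := (Finset.univ : Finset (Fin u))) E
  rw [Finset.card_univ, Fintype.card_fin] at hs
  have hs' : ((Finset.univ.filter E).card : ℝ) +
      ((Finset.univ.filter fun β => ¬ E β).card : ℝ) = u := by exact_mod_cast hs
  linarith

open Classical in
/-- The number of `a`-sets containing a pair of partitions with a large intersection. -/
lemma card_bad_sets_le {n u v a s : ℕ} {δ : ℝ} (hu : 0 < u) (hδ : 0 ≤ δ)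
    (P : Fin u → Fin v → Finset (Fin n))
    (hpr : ∀ α i j, 1 - δ ≤ uPr (fun β : Fin u => (P α i ∩ P β j).card ≤ s)) :
    (((Finset.powersetCard a (Finset.univ : Finset (Fin u))).filter fun I =>
      ¬ ∀ α ∈ I, ∀ β ∈ I, α ≠ β → ∀ i j, (P α i ∩ P β j).card ≤ s).card : ℝ) ≤
      2 * a ^ 2 * v ^ 2 * δ * u.choose a := by
  set bad : Finset (Fin u × Fin u) := Finset.univ.filter fun p =>
    p.1 ≠ p.2 ∧ ∃ i j, ¬ (P p.1 i ∩ P p.2 j).card ≤ s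
  set cont : Fin u × Fin u → Finset (Finset (Fin u)) := fun p =>
    (Finset.powersetCard a (Finset.univ : Finset (Fin u))).filter fun I => p.1 ∈ I ∧ p.2 ∈ I
  have hu' : (0 : ℝ) < u := by exact_mod_cast hu
  have hsub : ((Finset.powersetCard a (Finset.univ : Finset (Fin u))).filter fun I =>
      ¬ ∀ α ∈ I, ∀ β ∈ I, α ≠ β → ∀ i j, (P α i ∩ P β j).card ≤ s) ⊆ bad.biUnion cont := by
    intro I hI
    rw [Finset.mem_filter] at hI
    obtain ⟨hIa, hI⟩ := hI
    push Not at hI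
    obtain ⟨α, hα, β, hβ, hne, i, j, hij⟩ := hI
    refine Finset.mem_biUnion.2 ⟨(α, β), ?_, ?_⟩
    · simp only [bad, Finset.mem_filter, Finset.mem_univ, true_and]
      exact ⟨hne, i, j, not_le.2 hij⟩
    · exact Finset.mem_filter.2 ⟨hIa, hα, hβ⟩
  have hbad : (bad.card : ℝ) ≤ v ^ 2 * δ * u ^ 2 := by
    have hsub' : bad ⊆ (Finset.univ : Finset (Fin u × Fin v × Fin v)).biUnion fun q =>
        (Finset.univ.filter fun β => ¬ (P q.1 q.2.1 ∩ P β q.2.2).card ≤ s).image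
          fun β => (q.1, β) := by
      rintro ⟨α, β⟩ hp
      simp only [bad, Finset.mem_filter, Finset.mem_univ, true_and] at hp
      obtain ⟨-, i, j, hij⟩ := hp
      exact Finset.mem_biUnion.2 ⟨(α, i, j), Finset.mem_univ _,
        Finset.mem_image.2 ⟨β, Finset.mem_filter.2 ⟨Finset.mem_univ _, hij⟩, rfl⟩⟩
    have hle := (Finset.card_le_card hsub').trans Finset.card_biUnion_le
    calc (bad.card : ℝ) ≤ ∑ q : Fin u × Fin v × Fin v,
          ((Finset.univ.filter fun β => ¬ (P q.1 q.2.1 ∩ P β q.2.2).card ≤ s).image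
            fun β => (q.1, β)).card := by exact_mod_cast hle
      _ ≤ ∑ _q : Fin u × Fin v × Fin v, δ * u := by
          rw [Nat.cast_sum]
          refine Finset.sum_le_sum fun q _ => ?_
          exact (Nat.cast_le.2 Finset.card_image_le).trans
            (card_filter_not_le_of_uPr hu _ (hpr q.1 q.2.1 q.2.2))
      _ = _ := by
          simp [Finset.sum_const, Fintype.card_prod]; ring
  have hcard := (Finset.card_le_card hsub).trans Finset.card_biUnion_le
  refine le_of_mul_le_mul_right ?_ (pow_pos hu' 2)
  calc _ ≤ ((∑ p ∈ bad, (cont p).card : ℕ) : ℝ) * (u : ℝ) ^ 2 := by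
        gcongr
    _ = ∑ p ∈ bad, ((cont p).card : ℝ) * (u : ℝ) ^ 2 := by
        push_cast; rw [Finset.sum_mul]
    _ ≤ ∑ _p ∈ bad, 2 * (a : ℝ) ^ 2 * u.choose a := by
        refine Finset.sum_le_sum fun p hp => ?_
        exact card_filter_pair_mem_le (Finset.mem_filter.1 hp).2.1
    _ = bad.card * (2 * (a : ℝ) ^ 2 * u.choose a) := by
        rw [Finset.sum_const, nsmul_eq_mul]
    _ ≤ (v ^ 2 * δ * u ^ 2) * (2 * (a : ℝ) ^ 2 * u.choose a) := by gcongr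
    _ = _ := by ring

end Designs

section Constants

lemma mul_succ_sq_le (k : ℕ) : (k * (k + 1)) ^ 2 ≤ 64 * 2 ^ k := by
  rcases lt_or_ge k 6 with hk | hk
  · interval_cases k <;> norm_num
  induction k, hk using Nat.le_induction with
  | base => norm_num
  | succ k hk ih =>
    rw [pow_succ 2 k]
    have h : (k + 1 + 1) ^ 2 ≤ 2 * k ^ 2 := by nlinarith
    nlinarith [Nat.mul_le_mul_right ((k + 1) ^ 2) h]

lemma sq_mul_succ_le (d : ℕ) : d ^ 2 * (d + 1) ≤ 8 * 2 ^ d := by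
  rcases lt_or_ge d 5 with hd | hd
  · interval_cases d <;> norm_num
  induction d, hd using Nat.le_induction with
  | base => norm_num
  | succ d hd ih =>
    rw [pow_succ 2 d]
    have h : (d + 1) * (d + 1 + 1) ≤ 2 * d ^ 2 := by nlinarith
    nlinarith [Nat.mul_le_mul_right (d + 1) h]

lemma mul_succ_mul_half_pow_le (k : ℕ) :
    (k : ℝ) * (k + 1) * (1 / 2) ^ k ≤ 8 * 2 ^ (-(1 / 2 * (k : ℝ))) := by
  have hsq : ((2 : ℝ) ^ (-(1 / 2 * (k : ℝ)))) ^ 2 = (1 / 2) ^ k := by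
    rw [← Real.rpow_natCast, ← Real.rpow_mul (by norm_num)]
    rw [show -(1 / 2 * (k : ℝ)) * (2 : ℕ) = -(k : ℝ) by push_cast; ring,
      Real.rpow_neg (by norm_num), Real.rpow_natCast, one_div, inv_pow]
  have hk : ((k : ℝ) * (k + 1)) ^ 2 ≤ 64 * 2 ^ k := by exact_mod_cast mul_succ_sq_le k
  refine le_of_sq_le_sq ?_ (by positivity)
  have h21 : (2 : ℝ) ^ k * (1 / 2) ^ k = 1 := by rw [← mul_pow]; norm_num
  rw [mul_pow, mul_pow 8, hsq]
  calc _ ≤ (64 * 2 ^ k) * ((1 / 2 : ℝ) ^ k) ^ 2 := by gcongr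
    _ = 64 * (1 / 2) ^ k * (2 ^ k * (1 / 2) ^ k) := by ring
    _ = _ := by rw [h21]; norm_num

lemma exp_le_two_rpow {y : ℝ} (hy : 0 ≤ y) : Real.exp y ≤ 2 ^ (2 * y) := by
  rw [Real.rpow_def_of_pos (by norm_num)]
  refine Real.exp_le_exp.2 ?_
  nlinarith [Real.log_two_gt_d9]

lemma le_two_rpow {K : ℝ} (hK : 1 ≤ K) : K ≤ 2 ^ K := by
  have := one_add_mul_self_le_rpow_one_add (s := 1) (by norm_num) hK
  norm_num at this
  linarith

end Constants

lemma good_exponent_le {K : ℝ} {v w d k a : ℕ} (hK : 1 ≤ K) (hdk : d ≤ k) (had : a ≤ d)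
    (hv : (v : ℝ) ≤ K * w * 2 ^ w) :
    2 * ((a : ℝ) ^ 2 * v * ((k + 1) * (1 / 2) ^ (w + k))) ≤
      41 * K * w * d * 2 ^ (-(1 / 2 * (k : ℝ))) := by
  have h21 : (2 : ℝ) ^ w * (1 / 2) ^ w = 1 := by rw [← mul_pow]; norm_num
  have ha : (a : ℝ) ^ 2 ≤ d * k := by
    have : a ^ 2 ≤ d * k := by nlinarith [had.trans hdk]
    exact_mod_cast this
  have hk := mul_succ_mul_half_pow_le k
  have hR : (0 : ℝ) ≤ 2 ^ (-(1 / 2 * (k : ℝ))) := by positivity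
  have hK0 : 0 ≤ K := by linarith
  calc _ ≤ 2 * ((d * k : ℝ) * (K * w * 2 ^ w) * ((k + 1) * (1 / 2) ^ (w + k))) := by gcongr
    _ = 2 * K * w * d * (k * (k + 1) * (1 / 2) ^ k) * (2 ^ w * (1 / 2) ^ w) := by
        rw [pow_add]; ring
    _ ≤ 2 * K * w * d * (8 * 2 ^ (-(1 / 2 * (k : ℝ)))) := by
        rw [h21, mul_one]; gcongr
    _ = 16 * (K * w * d * 2 ^ (-(1 / 2 * (k : ℝ)))) := by ring
    _ ≤ 41 * (K * w * d * 2 ^ (-(1 / 2 * (k : ℝ)))) := by gcongr; norm_num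
    _ = _ := by ring

lemma general_exponent_le {K : ℝ} {v w d a : ℕ} (hK : 1 ≤ K) (had : a ≤ d)
    (hv : (v : ℝ) ≤ K * w * 2 ^ w) :
    2 * ((a : ℝ) ^ 2 * v * ((d + 1) * (1 / 2) ^ (w + d))) ≤ 16 * K * w := by
  have h21 : (2 : ℝ) ^ w * (1 / 2) ^ w = 1 := by rw [← mul_pow]; norm_num
  have h21' : (2 : ℝ) ^ d * (1 / 2) ^ d = 1 := by rw [← mul_pow]; norm_num
  have hd : (d : ℝ) ^ 2 * (d + 1) ≤ 8 * 2 ^ d := by exact_mod_cast sq_mul_succ_le d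
  have hK0 : 0 ≤ K := by linarith
  calc _ ≤ 2 * ((d : ℝ) ^ 2 * (K * w * 2 ^ w) * ((d + 1) * (1 / 2) ^ (w + d))) := by gcongr
    _ = 2 * K * w * ((d : ℝ) ^ 2 * (d + 1)) * (1 / 2) ^ d * (2 ^ w * (1 / 2) ^ w) := by
        rw [pow_add]; ring
    _ ≤ 2 * K * w * (8 * 2 ^ d) * (1 / 2) ^ d * (2 ^ w * (1 / 2) ^ w) := by gcongr
    _ = 16 * K * w * (2 ^ d * (1 / 2) ^ d) * (2 ^ w * (1 / 2) ^ w) := by ring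
    _ = _ := by rw [h21, h21']; ring

lemma bad_contribution_le {K : ℝ} {v w a : ℕ} (hK : 1 ≤ K) (hw : 0 < w) (haw : a ≤ w)
    (hv : (v : ℝ) ≤ K * w * 2 ^ w) :
    2 * (a : ℝ) ^ 2 * v ^ 2 * Real.exp (16 * K * w) ≤ 2 ^ (41 * K * w) := by
  have hw1 : (1 : ℝ) ≤ w := by exact_mod_cast hw
  have hK0 : 0 ≤ K := by linarith
  have hw2 : (w : ℝ) ≤ 2 ^ (w : ℝ) := by
    rw [Real.rpow_natCast]; exact_mod_cast Nat.lt_two_pow_self.le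
  have hKw : K ≤ 2 ^ (K * w) :=
    (le_two_rpow hK).trans (Real.rpow_le_rpow_of_exponent_le (by norm_num) (by nlinarith))
  have h2w : (2 : ℝ) ≤ 2 ^ (w : ℝ) := by
    simpa using Real.rpow_le_rpow_of_exponent_le (x := 2) (by norm_num) hw1
  have haw' : (a : ℝ) ≤ 2 ^ (w : ℝ) := le_trans (by exact_mod_cast haw) hw2
  have hv' : (v : ℝ) ≤ 2 ^ (K * w) * 2 ^ (w : ℝ) * 2 ^ (w : ℝ) := by
    refine hv.trans ?_
    rw [← Real.rpow_natCast 2 w]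
    gcongr
  have hexp := exp_le_two_rpow (y := 16 * K * w) (by positivity)
  calc _ ≤ (2 : ℝ) ^ (w : ℝ) * (2 ^ (w : ℝ)) ^ 2 *
        (2 ^ (K * w) * 2 ^ (w : ℝ) * 2 ^ (w : ℝ)) ^ 2 * 2 ^ (2 * (16 * K * w)) := by gcongr
    _ = 2 ^ (7 * (w : ℝ) + 34 * (K * w)) := by
        simp only [← Real.rpow_natCast, ← Real.rpow_add (by norm_num : (0 : ℝ) < 2),
          ← Real.rpow_mul (by norm_num : (0 : ℝ) ≤ 2)]
        congr 1
        push_cast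
        ring
    _ ≤ _ := Real.rpow_le_rpow_of_exponent_le (by norm_num) (by nlinarith)

lemma one_sub_tribeInd {n v : ℕ} (P : Fin v → Finset (Fin n)) (x : Fin n → Bool) :
    1 - tribeInd P x = ∏ j, (1 - termInd (P j) x) := by
  unfold tribeInd
  split_ifs with h
  · obtain ⟨j, hj⟩ := h
    rw [sub_self, Finset.prod_eq_zero (Finset.mem_univ j)]
    rw [termInd_eq_ite, if_pos hj, sub_self]
  · rw [sub_zero, Finset.prod_eq_one]
    intro j _
    rw [termInd_eq_ite, if_neg fun hj => h ⟨j, hj⟩, sub_zero]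

lemma expectation_esymm_eq {n u v a : ℕ} (P : Fin u → Fin v → Finset (Fin n)) :
    (∑ x : Fin n → Bool, ∑ I ∈ Finset.powersetCard a (Finset.univ : Finset (Fin u)),
      ∏ α ∈ I, (1 - tribeInd (P α) x)) / 2 ^ n =
    ∑ I ∈ Finset.powersetCard a (Finset.univ : Finset (Fin u)),
      cubeExp (noTerm (fun p : Fin u × Fin v => P p.1 p.2) (I ×ˢ Finset.univ)) := by
  rw [← cubeExp_sum]
  simp only [cubeExp, noTerm, one_sub_tribeInd, Finset.prod_product]

theorem statement4 (K : ℝ) (hK : 1 ≤ K) :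
    ∃ C c : ℝ, 1 ≤ C ∧ 0 < c ∧
      ∀ (u v w d k a : ℕ) (δ : ℝ) (P : Fin u → Fin v → Finset (Fin (v*w))),
        0 < u → 0 < v → 0 < w →
        -- `P α` is a partition of `[n]`, `n = v·w`, into `v` blocks of size `w`
        (∀ α j, (P α j).card = w) →
        (∀ α, ∀ i j, i ≠ j → Disjoint (P α i) (P α j)) →
        (∀ α x, ∃ j, x ∈ P α j) →
        d ≤ k → k ≤ w → 0 < δ → δ < 1 →
        -- `(d,k,δ)`-design
        (∀ α β, α ≠ β → ∀ i j, ((P α i) ∩ (P β j)).card ≤ w - d) →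
        (∀ α i j, 1 - δ ≤ uPr (fun β : Fin u => ((P α i) ∩ (P β j)).card ≤ w - k)) →
        ((v:ℝ) ≤ K * w * 2^w) →
        1 ≤ a → a ≤ d →
        -- the two bounds on `E[S_a(1-Z_1,…,1-Z_u)]`
        ((u.choose a : ℝ) * (1 - (1/2:ℝ)^w)^(v*a) ≤
          (∑ x : Fin (v*w) → Bool,
            ∑ I ∈ Finset.powersetCard a (Finset.univ : Finset (Fin u)),
              ∏ α ∈ I, (1 - tribeInd (P α) x)) / 2^(v*w)) ∧
        ((∑ x : Fin (v*w) → Bool,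
            ∑ I ∈ Finset.powersetCard a (Finset.univ : Finset (Fin u)),
              ∏ α ∈ I, (1 - tribeInd (P α) x)) / 2^(v*w) ≤
          (Real.exp (C * w * d * (2:ℝ)^(-(c * (k:ℝ)))) + (2:ℝ)^(C * (w:ℝ)) * δ) *
            (u.choose a) * (1 - (1/2:ℝ)^w)^(v*a)) := by
  have hK0 : 0 ≤ K := by linarith
  refine ⟨41 * K, 1 / 2, by linarith, by norm_num, ?_⟩
  intro u v w d k a δ P hu hv hw hcard hdisj hcover hdk hkw hδ hδ1 hdes hpr hvK ha had
  have hp : (0 : ℝ) ≤ 1 - (1 / 2) ^ w :=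
    sub_nonneg.2 (pow_le_one₀ (by norm_num) (by norm_num))
  have hTcard : ∀ I ∈ Finset.powersetCard a (Finset.univ : Finset (Fin u)),
      (I ×ˢ (Finset.univ : Finset (Fin v))).card = v * a := by
    intro I hI
    rw [Finset.card_product, (Finset.mem_powersetCard.1 hI).2, Finset.card_univ,
      Fintype.card_fin, mul_comm]
  rw [expectation_esymm_eq]
  constructor
  · calc _ = ∑ _I ∈ Finset.powersetCard a (Finset.univ : Finset (Fin u)),
          (1 - (1 / 2 : ℝ) ^ w) ^ (v * a) := by
          rw [Finset.sum_const, Finset.card_powersetCard, Finset.card_univ, Fintype.card_fin,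
            nsmul_eq_mul]
      _ ≤ _ := by
          refine Finset.sum_le_sum fun I hI => ?_
          rw [← hTcard I hI]
          exact pow_card_le_cubeExp_noTerm _ _ fun p _ => hcard p.1 p.2
  · classical
    set M := (1 - (1 / 2 : ℝ) ^ w) ^ (v * a)
    have hM : 0 ≤ M := pow_nonneg hp _
    set G := Real.exp (41 * K * w * d * 2 ^ (-(1 / 2 * (k : ℝ))))
    set good : Finset (Fin u) → Prop := fun I =>
      ∀ α ∈ I, ∀ β ∈ I, α ≠ β → ∀ i j, (P α i ∩ P β j).card ≤ w - k
    have hbound : ∀ t ≤ w, ∀ I ∈ Finset.powersetCard a (Finset.univ : Finset (Fin u)),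
        (∀ α ∈ I, ∀ β ∈ I, α ≠ β → ∀ i j, (P α i ∩ P β j).card ≤ w - t) →
        cubeExp (noTerm (fun p : Fin u × Fin v => P p.1 p.2) (I ×ˢ Finset.univ)) ≤
          M * Real.exp (2 * ((a : ℝ) ^ 2 * v * ((t + 1) * (1 / 2) ^ (w + t)))) := by
      intro t ht I hI hint
      have h1 := cubeExp_noTerm_le (fun p : Fin u × Fin v => P p.1 p.2) (I ×ˢ Finset.univ) hw
        fun p _ => hcard p.1 p.2
      have h2 := correlation_product_le hw ht P hcard hdisj I hint
      rw [(Finset.mem_powersetCard.1 hI).2] at h2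
      rw [hTcard I hI] at h1
      refine h1.trans ?_
      gcongr
    have hterm : ∀ I ∈ Finset.powersetCard a (Finset.univ : Finset (Fin u)),
        cubeExp (noTerm (fun p : Fin u × Fin v => P p.1 p.2) (I ×ˢ Finset.univ)) ≤
          M * G + if ¬ good I then M * Real.exp (16 * K * w) else 0 := by
      intro I hI
      split_ifs with hg
      · refine (hbound k hkw I hI hg).trans ?_
        rw [add_zero]
        exact mul_le_mul_of_nonneg_left
          (Real.exp_le_exp.2 (good_exponent_le hK hdk had hvK)) hM
      · refine (hbound d (hdk.trans hkw) I hI fun α _ β _ h => hdes α β h).trans ?_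
        refine le_add_of_nonneg_of_le (by positivity) ?_
        exact mul_le_mul_of_nonneg_left
          (Real.exp_le_exp.2 (general_exponent_le hK had hvK)) hM
    have hbad := card_bad_sets_le (a := a) hu hδ.le P hpr
    have hconst := bad_contribution_le hK hw (had.trans (hdk.trans hkw)) hvK
    calc _ ≤ _ := Finset.sum_le_sum hterm
      _ = u.choose a * (M * G) +
          ((Finset.powersetCard a (Finset.univ : Finset (Fin u))).filter
            fun I => ¬ good I).card * (M * Real.exp (16 * K * w)) := by
          rw [Finset.sum_add_distrib, ← Finset.sum_filter, Finset.sum_const, Finset.sum_const,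
            Finset.card_powersetCard, Finset.card_univ, Fintype.card_fin, nsmul_eq_mul,
            nsmul_eq_mul]
      _ ≤ u.choose a * (M * G) + (2 * a ^ 2 * v ^ 2 * δ * u.choose a) *
          (M * Real.exp (16 * K * w)) := by gcongr
      _ = u.choose a * (M * G) + (2 * (a : ℝ) ^ 2 * v ^ 2 * Real.exp (16 * K * w)) *
          (δ * u.choose a * M) := by ring
      _ ≤ u.choose a * (M * G) + 2 ^ (41 * K * w) * (δ * u.choose a * M) := by gcongr
      _ = _ := by ring
end

section
/- Let n = v·w and let 𝒫 = {P^1,…,P^u} be a collection of partitions of [n] into v blocks of size w that is (q,τ)-load balancing, where 1 ≤ q ≤ v. Then I_q(f_𝒫) ≤ ( u·(1 − 2^{−w})^{v−q} ) · ( τ·2^{−w} ) · q. -/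
open Finset

/-- The event that `f` is not determined by the assignment `x` to coordinates outside `Q`. -/
def Undet {n : ℕ} (F : (Fin n → Bool) → Prop) (Q : Finset (Fin n)) (x : Fin n → Bool) : Prop :=
  ∃ y z : Fin n → Bool, (∀ i ∉ Q, y i = x i) ∧ (∀ i ∉ Q, z i = x i) ∧ ¬(F y ↔ F z)

/-- The Tribes event for the partition with blocks `P j`. -/
def TribesP {n v : ℕ} (P : Fin v → Finset (Fin n)) (x : Fin n → Bool) : Prop :=
  ∃ j, ∀ k ∈ P j, x k = true

theorem uPr_eq_card_filter {α : Type*} [Fintype α] (E : α → Prop) [DecidablePred E] :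
    uPr E = ((univ.filter E).card : ℝ) / Fintype.card α := by
  rw [uPr, Nat.card_eq_fintype_card, Fintype.card_subtype]

theorem uPr_mono {α : Type*} [Fintype α] {E F : α → Prop} (h : ∀ x, E x → F x) :
    uPr E ≤ uPr F := by
  classical
  rw [uPr_eq_card_filter, uPr_eq_card_filter]
  gcongr with x
  exact h x

theorem uPr_true {α : Type*} [Fintype α] [Nonempty α] : uPr (fun _ : α => True) = 1 := by
  classical
  rw [uPr_eq_card_filter]
  simp

theorem uPr_exists_le {α ι : Type*} [Fintype α] (s : Finset ι) (E : ι → α → Prop) :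
    uPr (fun x => ∃ i ∈ s, E i x) ≤ ∑ i ∈ s, uPr (E i) := by
  classical
  simp only [uPr_eq_card_filter, ← Finset.sum_div]
  gcongr
  have : univ.filter (fun x => ∃ i ∈ s, E i x) = s.biUnion fun i => univ.filter (E i) := by
    ext x; simp
  rw [this]
  exact_mod_cast card_biUnion_le

theorem uPr_and_add_not_and {α : Type*} [Fintype α] (E F : α → Prop) :
    uPr (fun x => E x ∧ F x) + uPr (fun x => ¬ E x ∧ F x) = uPr F := by
  classical
  simp only [uPr_eq_card_filter, ← add_div]
  congr 1
  have := card_filter_add_card_filter_not (s := univ.filter F) E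
  simp only [filter_filter, and_comm] at this ⊢
  exact_mod_cast this

theorem uPr_comp_equiv {α : Type*} [Fintype α] (e : α ≃ α) (E : α → Prop) :
    uPr (fun x => E (e x)) = uPr E := by
  unfold uPr
  rw [Nat.card_congr (e.subtypeEquiv (p := fun x => E (e x)) (q := E) fun _ => Iff.rfl)]

section Cube

variable {ι : Type*} [DecidableEq ι]

/-- Flipping one coordinate of the cube. -/
def flipEquiv (a : ι) : (ι → Bool) ≃ (ι → Bool) :=
  Function.Involutive.toPerm (fun x => Function.update x a (!x a)) fun x => by
    funext i; by_cases h : i = a <;> simp [h]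

theorem flipEquiv_apply (a : ι) (x : ι → Bool) :
    flipEquiv a x = Function.update x a (!x a) := rfl

variable [Fintype ι]

theorem uPr_coord_and (a : ι) (G : (ι → Bool) → Prop)
    (hG : ∀ x y, (∀ i, i ≠ a → x i = y i) → (G x ↔ G y)) :
    uPr (fun x => x a = true ∧ G x) = 1 / 2 * uPr G := by
  have h1 := uPr_and_add_not_and (fun x : ι → Bool => x a = true) G
  have h2 := uPr_comp_equiv (flipEquiv a) (fun x => x a = true ∧ G x)
  have h3 : (fun x : ι → Bool => flipEquiv a x a = true ∧ G (flipEquiv a x)) =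
      fun x => ¬ x a = true ∧ G x := by
    funext x
    have : G (flipEquiv a x) ↔ G x := hG _ _ fun i hi => by simp [flipEquiv_apply, hi]
    rw [this]
    simp [flipEquiv_apply]
  rw [h3] at h2
  linarith

theorem uPr_forall_and (A : Finset ι) (G : (ι → Bool) → Prop)
    (hG : ∀ x y, (∀ i ∉ A, x i = y i) → (G x ↔ G y)) :
    uPr (fun x => (∀ k ∈ A, x k = true) ∧ G x) = (1 / 2) ^ A.card * uPr G := by
  induction A using Finset.induction_on with
  | empty => simp
  | insert a A ha ih =>
    have h := uPr_coord_and a (fun x => (∀ k ∈ A, x k = true) ∧ G x) fun x y hxy => by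
      refine and_congr (forall₂_congr fun k hk => ?_) (hG x y fun i hi => hxy i ?_)
      · rw [hxy k (by rintro rfl; exact ha hk)]
      · rintro rfl; simp at hi
    rw [ih fun x y hxy => hG x y fun i hi => hxy i (by simp_all)] at h
    simp only [forall_mem_insert, and_assoc, card_insert_of_notMem ha, pow_succ']
    rw [h, mul_assoc]

theorem uPr_forall_not_forall {κ : Type*} (S : Finset κ) (B : κ → Finset ι) (w : ℕ)
    (hcard : ∀ j, (B j).card = w) (hdisj : ∀ i j, i ≠ j → Disjoint (B i) (B j)) :
    uPr (fun x : ι → Bool => ∀ j ∈ S, ¬ ∀ k ∈ B j, x k = true) = (1 - (1 / 2) ^ w) ^ S.card := by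
  classical
  induction S using Finset.induction_on with
  | empty => simp [uPr_true]
  | insert a S ha ih =>
    have h1 := uPr_and_add_not_and (fun x : ι → Bool => ∀ k ∈ B a, x k = true)
      (fun x => ∀ j ∈ S, ¬ ∀ k ∈ B j, x k = true)
    rw [uPr_forall_and, ih, hcard] at h1
    · simp only [forall_mem_insert, card_insert_of_notMem ha, pow_succ]
      linarith
    · intro x y hxy
      refine forall₂_congr fun j hj => not_congr (forall₂_congr fun k hk => ?_)
      rw [hxy k]
      exact disjoint_left.1 (hdisj j a (by rintro rfl; exact ha hj)) hk

theorem uPr_block_and_others_le {v w q : ℕ} (B : Fin v → Finset ι)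
    (hcard : ∀ j, (B j).card = w) (hdisj : ∀ i j, i ≠ j → Disjoint (B i) (B j))
    (Q : Finset ι) (hQ : Q.card ≤ q) (j : Fin v) (hj : (Q ∩ B j).Nonempty) :
    uPr (fun x : ι → Bool => (∀ k ∈ B j \ Q, x k = true) ∧
      ∀ i ∈ univ.filter (fun i => ¬ (Q ∩ B i).Nonempty), ¬ ∀ k ∈ B i, x k = true) ≤
    2 ^ (Q ∩ B j).card * (1 / 2 : ℝ) ^ w * (1 - (1 / 2) ^ w) ^ (v - q) := by
  rw [uPr_forall_and, uPr_forall_not_forall _ B w hcard hdisj]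
  · have hpow : (1 / 2 : ℝ) ^ (B j \ Q).card = 2 ^ (Q ∩ B j).card * (1 / 2 : ℝ) ^ w := by
      rw [← hcard j, ← card_sdiff_add_card_inter (B j) Q, inter_comm Q, pow_add,
        mul_left_comm, ← mul_pow]
      norm_num
    have hmeet : (univ.filter fun i => (Q ∩ B i).Nonempty).card ≤ q := by
      refine le_trans ?_ hQ
      have : Nonempty ι := ⟨hj.choose⟩
      choose! f hf using fun (i : Fin v) (hi : (Q ∩ B i).Nonempty) => hi
      refine card_le_card_of_injOn f (fun i hi => ?_) fun i hi i' hi' hii => ?_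
      · exact (mem_inter.1 (hf i (by simpa using hi))).1
      · by_contra hne
        have h1 := (mem_inter.1 (hf i (by simpa using hi))).2
        have h2 := (mem_inter.1 (hf i' (by simpa using hi'))).2
        exact disjoint_left.1 (hdisj i i' hne) h1 (hii ▸ h2)
    have hsum := card_filter_add_card_filter_not (s := (univ : Finset (Fin v)))
      (fun i => (Q ∩ B i).Nonempty)
    rw [card_univ, Fintype.card_fin] at hsum
    have hle : (1 / 2 : ℝ) ^ w ≤ 1 := pow_le_one₀ (by norm_num) (by norm_num)
    have hpos : (0 : ℝ) ≤ (1 / 2) ^ w := by positivity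
    rw [hpow]
    exact mul_le_mul_of_nonneg_left
      (pow_le_pow_of_le_one (by linarith) (by linarith) (by omega)) (by positivity)
  · intro x y hxy
    refine forall₂_congr fun i hi => not_congr (forall₂_congr fun k hk => ?_)
    rw [hxy k]
    have hne : i ≠ j := by rintro rfl; exact (mem_filter.1 hi).2 hj
    exact fun h => disjoint_left.1 (hdisj i j hne) hk (mem_sdiff.1 h).1

end Cube

theorem Undet.exists_block {n u v : ℕ} {P : Fin u → Fin v → Finset (Fin n)}
    {Q : Finset (Fin n)} {x : Fin n → Bool}
    (h : Undet (fun x => ∀ α, TribesP (P α) x) Q x) :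
    ∃ α, ∃ j, (Q ∩ P α j).Nonempty ∧ (∀ k ∈ P α j \ Q, x k = true) ∧
      ∀ i ∈ univ.filter (fun i => ¬ (Q ∩ P α i).Nonempty), ¬ ∀ k ∈ P α i, x k = true := by
  obtain ⟨y, z, hy, hz, hyz⟩ := h
  wlog hzt : ∀ α, TribesP (P α) z generalizing y z
  · exact this z y hz hy (fun h => hyz h.symm) (by by_contra hyf; exact hyz (by tauto))
  have hyf : ¬ ∀ α, TribesP (P α) y := fun h => hyz ⟨fun _ => hzt, fun _ => h⟩
  push Not at hyf
  obtain ⟨α, hα⟩ := hyf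
  have hothers : ∀ i, ¬ (Q ∩ P α i).Nonempty → ¬ ∀ k ∈ P α i, x k = true := by
    intro i hi hall
    refine hα ⟨i, fun k hk => ?_⟩
    rw [hy k fun hkQ => hi ⟨k, mem_inter.2 ⟨hkQ, hk⟩⟩]
    exact hall k hk
  obtain ⟨j, hj⟩ := hzt α
  refine ⟨α, j, ?_, fun k hk => ?_, fun i hi => hothers i (mem_filter.1 hi).2⟩
  · by_contra hne
    refine hothers j hne fun k hk => ?_
    rw [← hz k fun hkQ => hne ⟨k, mem_inter.2 ⟨hkQ, hk⟩⟩]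
    exact hj k hk
  · rw [mem_sdiff] at hk
    rw [← hz k hk.2]
    exact hj k hk.1

theorem statement5 (u v w q : ℕ) (τ : ℝ)
    (hu : 0 < u) (hv : 0 < v) (hw : 0 < w) (hq1 : 1 ≤ q) (hqv : q ≤ v)
    (P : Fin u → Fin v → Finset (Fin (v*w)))
    -- `P α` is a partition of `[n]`, `n = v·w`, into `v` blocks of size `w`
    (hcard : ∀ α j, (P α j).card = w)
    (hdisj : ∀ α, ∀ i j, i ≠ j → Disjoint (P α i) (P α j))
    (hcover : ∀ α x, ∃ j, x ∈ P α j)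
    -- `(q,τ)`-load balancing
    (hlb : ∀ Q : Finset (Fin (v*w)), Q.card ≤ q → ∀ j : Fin v,
      (∑ α : Fin u, if (Q ∩ P α j).Nonempty then (2:ℝ)^((Q ∩ P α j).card) else 0) / u ≤
        τ * q / v)
    (Q : Finset (Fin (v*w))) (hQ : Q.card ≤ q) :
    uPr (Undet (fun x => ∀ α, TribesP (P α) x) Q) ≤
      ((u : ℝ) * (1 - (1/2:ℝ)^w)^(v - q)) * (τ * (1/2:ℝ)^w) * q := by
  have hle : (1 / 2 : ℝ) ^ w ≤ 1 := pow_le_one₀ (by norm_num) (by norm_num)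
  set c : ℝ := (1 / 2 : ℝ) ^ w * (1 - (1 / 2) ^ w) ^ (v - q) with hc
  have hc0 : 0 ≤ c := mul_nonneg (by positivity) (pow_nonneg (by linarith) _)
  have hu' : (0 : ℝ) < u := by exact_mod_cast hu
  have hv' : (0 : ℝ) < v := by exact_mod_cast hv
  calc uPr (Undet (fun x => ∀ α, TribesP (P α) x) Q)
      ≤ uPr (fun x => ∃ p ∈ (univ : Finset (Fin u × Fin v)), (Q ∩ P p.1 p.2).Nonempty ∧
          (∀ k ∈ P p.1 p.2 \ Q, x k = true) ∧
          ∀ i ∈ univ.filter (fun i => ¬ (Q ∩ P p.1 i).Nonempty), ¬ ∀ k ∈ P p.1 i, x k = true) :=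
        uPr_mono fun x hx => by
          obtain ⟨α, j, h⟩ := hx.exists_block
          exact ⟨(α, j), mem_univ _, h⟩
    _ ≤ ∑ p : Fin u × Fin v,
          (if (Q ∩ P p.1 p.2).Nonempty then (2 : ℝ) ^ (Q ∩ P p.1 p.2).card else 0) * c := by
        refine (uPr_exists_le _ _).trans (sum_le_sum fun p _ => ?_)
        split_ifs with hp
        · simp only [hp, true_and]
          rw [hc, ← mul_assoc]
          exact uPr_block_and_others_le (P p.1) (hcard p.1) (hdisj p.1) Q hQ p.2 hp
        · simp [hp, uPr]
    _ = ∑ j : Fin v, (∑ α : Fin u,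
          if (Q ∩ P α j).Nonempty then (2 : ℝ) ^ (Q ∩ P α j).card else 0) / u * (u * c) := by
        rw [Fintype.sum_prod_type_right]
        refine sum_congr rfl fun j _ => ?_
        rw [← sum_mul]
        field_simp
    _ ≤ ∑ _j : Fin v, τ * q / v * (u * c) :=
        sum_le_sum fun j _ => mul_le_mul_of_nonneg_right (hlb Q hQ j) (by positivity)
    _ = ((u : ℝ) * (1 - (1/2:ℝ)^w)^(v - q)) * (τ * (1/2:ℝ)^w) * q := by
        rw [sum_const, card_univ, Fintype.card_fin, nsmul_eq_mul, hc]
        field_simp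
end

section
/- Let v be a prime, and let ℓ, w be integers with 1 ≤ ℓ ≤ w < v. For y ∈ (ℤ/vℤ)^ℓ define α(y) ∈ (ℤ/vℤ)^w by α(y)_i = Σ_{j=1}^ℓ y_j·i^j (mod v) for i = 1,…,w, and let P^{α(y)} be the associated partition of [v·w]. Then the collection 𝒫 = { P^{α(y)} : y ∈ (ℤ/vℤ)^ℓ } is a (w−ℓ)-design: for all y ≠ y' ∈ (ℤ/vℤ)^ℓ and all i,j ∈ [v], |P^{α(y)}_i ∩ P^{α(y')}_j| ≤ ℓ. -/
open Finset

/-- The `i`-th block of the partition `P^α` of `[v·w]` associated to `α ∈ (ℤ/v)^w`: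
`P^α_i = { (k−1)·v + ((i − α_k) mod v) : k ∈ [w] }` (0-indexed). -/
def blockP {v w : ℕ} (α : Fin w → ZMod v) (i : Fin v) : Finset (Fin (v * w)) :=
  Finset.univ.image (fun k : Fin w =>
    (⟨k.1 * v + ((((i.1 : ZMod v) - α k).val) % v), by
      have hv : 0 < v := Nat.lt_of_le_of_lt (Nat.zero_le _) i.2
      have h1 : ((((i.1 : ZMod v) - α k).val) % v) < v := Nat.mod_lt _ hv
      have h2 : k.1 + 1 ≤ w := k.2
      calc k.1 * v + ((((i.1 : ZMod v) - α k).val) % v) < k.1 * v + v := by omega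
        _ = (k.1 + 1) * v := by ring
        _ ≤ w * v := Nat.mul_le_mul h2 (Nat.le_refl v)
        _ = v * w := Nat.mul_comm w v⟩ : Fin (v * w)))

/-- The Reed–Solomon string `α(y) ∈ (ℤ/v)^w`, `α(y)_i = Σ_{j=1}^ℓ y_j i^j`. -/
def alphaRS {v ℓ : ℕ} (w : ℕ) (y : Fin ℓ → ZMod v) : Fin w → ZMod v :=
  fun i => ∑ j : Fin ℓ, y j * ((i.1 + 1 : ℕ) : ZMod v) ^ (j.1 + 1)

/-- The polynomial `c + ∑ j, z j * X ^ (j + 1)`. -/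
noncomputable def shiftedPoly {R : Type*} [CommRing R] {ℓ : ℕ} (c : R) (z : Fin ℓ → R) :
    Polynomial R :=
  Polynomial.C c + ∑ j : Fin ℓ, Polynomial.C (z j) * Polynomial.X ^ (j.1 + 1)

lemma shiftedPoly_coeff_succ {R : Type*} [CommRing R] {ℓ : ℕ} (c : R) (z : Fin ℓ → R)
    (j : Fin ℓ) : (shiftedPoly c z).coeff (j.1 + 1) = z j := by
  simp [shiftedPoly, Polynomial.coeff_X_pow, Fin.val_inj]

lemma natDegree_shiftedPoly_le {R : Type*} [CommRing R] {ℓ : ℕ} (c : R) (z : Fin ℓ → R) :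
    (shiftedPoly c z).natDegree ≤ ℓ := by
  refine Polynomial.natDegree_add_le_of_degree_le (by simp) ?_
  refine Polynomial.natDegree_sum_le_of_forall_le _ _ fun j _ => ?_
  exact (Polynomial.natDegree_C_mul_X_pow_le _ _).trans j.2

lemma eval_shiftedPoly {R : Type*} [CommRing R] {ℓ : ℕ} (c : R) (z : Fin ℓ → R) (x : R) :
    (shiftedPoly c z).eval x = c + ∑ j : Fin ℓ, z j * x ^ (j.1 + 1) := by
  simp [shiftedPoly, Polynomial.eval_finsetSum]

/-- The size of the intersection of two blocks is at most the number of positions `k` at which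
the two shifted strings agree. -/
lemma card_blockP_inter_le {v w : ℕ} [NeZero v] (α β : Fin w → ZMod v) (i j : Fin v) :
    (blockP α i ∩ blockP β j).card ≤
      #{k : Fin w | (i.1 : ZMod v) - α k = (j.1 : ZMod v) - β k} := by
  have hv : 0 < v := NeZero.pos v
  have key (γ : Fin w → ZMod v) (l : Fin v) : ∃ f : Fin w → Fin (v * w),
      blockP γ l = univ.image f ∧ ∀ k, (f k).1 = k.1 * v + ((l.1 : ZMod v) - γ k).val :=
    ⟨_, rfl, fun k => by simp only [Nat.mod_eq_of_lt (ZMod.val_lt _)]⟩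
  obtain ⟨f, hf, hf_val⟩ := key α i
  obtain ⟨g, hg, hg_val⟩ := key β j
  rw [hf, hg]
  refine (Finset.card_le_card (t := image f _) ?_).trans Finset.card_image_le
  intro x hx
  obtain ⟨hxi, hxj⟩ := Finset.mem_inter.mp hx
  obtain ⟨k, -, hk⟩ := Finset.mem_image.mp hxi
  obtain ⟨m, -, hm⟩ := Finset.mem_image.mp hxj
  refine Finset.mem_image.mpr ⟨k, Finset.mem_filter.mpr ⟨Finset.mem_univ _, ?_⟩, hk⟩
  have h := congrArg Fin.val (hk.trans hm.symm)
  rw [hf_val, hg_val] at h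
  have hdiv := congrArg (· / v) h
  have hmod := congrArg (· % v) h
  simp only [Nat.mul_add_mod', Nat.mod_eq_of_lt (ZMod.val_lt _)] at hmod
  simp only [Nat.add_comm (_ * v), Nat.add_mul_div_right _ _ hv,
    Nat.div_eq_of_lt (ZMod.val_lt _), Nat.zero_add] at hdiv
  obtain rfl : k = m := Fin.ext hdiv
  exact ZMod.val_injective v hmod

theorem statement11 (v ℓ w : ℕ) (hv : v.Prime) (hℓ1 : 1 ≤ ℓ) (hℓw : ℓ ≤ w) (hwv : w < v)
    (y y' : Fin ℓ → ZMod v) (hyy : y ≠ y') (i j : Fin v) :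
    ((blockP (alphaRS w y) i) ∩ (blockP (alphaRS w y') j)).card ≤ ℓ := by
  have : Fact v.Prime := ⟨hv⟩
  set p := shiftedPoly ((j.1 : ZMod v) - (i.1 : ZMod v)) (y - y') with hp
  have hp0 : p ≠ 0 := by
    intro h
    refine hyy (funext fun k => sub_eq_zero.mp ?_)
    have := shiftedPoly_coeff_succ ((j.1 : ZMod v) - (i.1 : ZMod v)) (y - y') k
    rw [← hp, h] at this
    simpa using this.symm
  have hinj : Function.Injective fun k : Fin w => ((k.1 + 1 : ℕ) : ZMod v) := by
    intro a b hab
    have h := (ZMod.natCast_eq_natCast_iff' _ _ _).mp hab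
    rw [Nat.mod_eq_of_lt (by omega), Nat.mod_eq_of_lt (by omega)] at h
    exact Fin.ext (Nat.succ_injective h)
  calc _ ≤ _ := card_blockP_inter_le _ _ i j
    _ ≤ p.roots.toFinset.card := by
      refine Finset.card_le_card_of_injOn _ (fun k hk => ?_) hinj.injOn
      have h := (Finset.mem_filter.mp hk).2
      rw [Finset.mem_coe, Multiset.mem_toFinset, Polynomial.mem_roots hp0, Polynomial.IsRoot.def,
        hp, eval_shiftedPoly]
      simp only [alphaRS] at h
      simp only [Pi.sub_apply, sub_mul, Finset.sum_sub_distrib]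
      linear_combination -h
    _ ≤ p.natDegree := (Multiset.toFinset_card_le _).trans (Polynomial.card_roots' p)
    _ ≤ ℓ := natDegree_shiftedPoly_le _ _
end

section
/- Let v be a prime and let ℓ, w be integers with 3 ≤ ℓ ≤ w/2 and w < v. For y ∈ (ℤ/vℤ)^ℓ define α(y) ∈ (ℤ/vℤ)^w by α(y)_i = Σ_{j=1}^ℓ y_j·i^j (mod v) for i = 1,…,w. Then for every integer 1 ≤ q ≤ v, the collection 𝒫 = { P^{α(y)} : y ∈ (ℤ/vℤ)^ℓ } (indexed by y, with α chosen via a uniformly random y) is (q,τ)-load balancing with τ = 2^ℓ + 2^w·(q/v)^{ℓ−1}: that is, for every Q ⊆ [v·w] with |Q| ≤ q and every j ∈ [v], E_{y uniform on (ℤ/vℤ)^ℓ}[ 1(Q ∩ P^{α(y)}_j ≠ ∅)·2^{|Q ∩ P^{α(y)}_j|} ] ≤ τ·q/v. -/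
open Finset

theorem mem_blockP {v w : ℕ} [NeZero v] {α : Fin w → ZMod v} {i : Fin v} {x : Fin (v * w)} :
    x ∈ blockP α i ↔ ∃ k : Fin w, k.1 * v + ((i.1 : ZMod v) - α k).val = x.1 := by
  simp only [blockP, mem_image, mem_univ, true_and, Fin.ext_iff,
    Nat.mod_eq_of_lt (ZMod.val_lt _)]

theorem eq_of_mul_add_val_eq {v w : ℕ} [NeZero v] {k k' : Fin w} {a b : ZMod v}
    (h : k.1 * v + a.val = k'.1 * v + b.val) : k = k' ∧ a = b := by
  have hv : 0 < v := NeZero.pos v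
  have hdiv : ∀ (n : ℕ) (c : ZMod v), (n * v + c.val) / v = n := fun n c => by
    rw [Nat.mul_comm, Nat.mul_add_div hv, Nat.div_eq_of_lt (ZMod.val_lt c), add_zero]
  have hk : k.1 = k'.1 := by rw [← hdiv k.1 a, h, hdiv]
  rw [hk] at h
  exact ⟨Fin.ext hk, ZMod.val_injective v (Nat.add_left_cancel h)⟩

theorem natCast_succ_ne_zero {v w : ℕ} (hwv : w < v) (k : Fin w) :
    ((k.1 + 1 : ℕ) : ZMod v) ≠ 0 := by
  rw [Ne, ZMod.natCast_eq_zero_iff]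
  exact Nat.not_dvd_of_pos_of_lt k.1.succ_pos (by omega)

theorem natCast_succ_injective {v w : ℕ} (hwv : w < v) :
    Function.Injective fun k : Fin w => ((k.1 + 1 : ℕ) : ZMod v) := by
  intro k k' h
  have h' := (ZMod.natCast_eq_natCast_iff' _ _ _).1 h
  rw [Nat.mod_eq_of_lt (by omega), Nat.mod_eq_of_lt (by omega)] at h'
  exact Fin.ext (by omega)

theorem alphaRS_eq_of_card_le {v ℓ w : ℕ} [Fact v.Prime] (hwv : w < v) {y z : Fin ℓ → ZMod v}
    {K : Finset (Fin w)} (hK : ℓ ≤ K.card) (h : ∀ k ∈ K, alphaRS w y k = alphaRS w z k) :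
    y = z := by
  obtain ⟨T, hTK, hT⟩ := exists_subset_card_eq hK
  have hinj : Function.Injective fun t : Fin ℓ =>
      ((((T.equivFinOfCardEq hT).symm t).1.1 + 1 : ℕ) : ZMod v) := by
    intro a b hab
    exact (T.equivFinOfCardEq hT).symm.injective (Subtype.ext (natCast_succ_injective hwv hab))
  have key := Matrix.eq_zero_of_forall_index_sum_mul_pow_eq_zero (v := y - z) hinj ?_
  · exact sub_eq_zero.1 key
  intro t
  set k := ((T.equivFinOfCardEq hT).symm t).1 with hk
  have hkT := h k (hTK ((T.equivFinOfCardEq hT).symm t).2)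
  apply (mul_eq_zero.1 _).resolve_left (natCast_succ_ne_zero hwv k)
  rw [← sub_eq_zero, alphaRS, alphaRS, ← sum_sub_distrib] at hkT
  rw [mul_sum, ← hkT]
  refine sum_congr rfl fun j _ => ?_
  simp only [Pi.sub_apply]
  ring

theorem card_filter_subset_blockP_le_one {v ℓ w : ℕ} [Fact v.Prime] (hwv : w < v) (i : Fin v)
    {S : Finset (Fin (v * w))} (hS : S.card = ℓ) :
    (univ.filter fun y : Fin ℓ → ZMod v => S ⊆ blockP (alphaRS w y) i).card ≤ 1 := by
  refine card_le_one.2 fun y hy z hz => ?_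
  rw [mem_filter] at hy hz
  refine alphaRS_eq_of_card_le hwv
    (K := univ.filter fun k => alphaRS w y k = alphaRS w z k) ?_ (by simp)
  calc ℓ = (S.image Fin.val).card := by rw [card_image_of_injective _ Fin.val_injective, hS]
    _ ≤ ((univ.filter fun k => alphaRS w y k = alphaRS w z k).image
          fun k : Fin w => k.1 * v + ((i.1 : ZMod v) - alphaRS w y k).val).card := by
        refine card_le_card fun n hn => ?_
        obtain ⟨x, hx, rfl⟩ := mem_image.1 hn
        obtain ⟨k, hk⟩ := mem_blockP.1 (hy.2 hx)
        obtain ⟨k', hk'⟩ := mem_blockP.1 (hz.2 hx)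
        obtain ⟨rfl, hval⟩ := eq_of_mul_add_val_eq (hk.trans hk'.symm)
        exact mem_image.2 ⟨k, by simpa using hval, hk⟩
    _ ≤ _ := card_image_le

theorem card_filter_mem_blockP_le {v m w : ℕ} [Fact v.Prime] (hwv : w < v) (i : Fin v)
    (x : Fin (v * w)) :
    (univ.filter fun y : Fin (m + 1) → ZMod v => x ∈ blockP (alphaRS w y) i).card ≤ v ^ m := by
  calc _ ≤ (univ : Finset (Fin m → ZMod v)).card := by
        refine card_le_card_of_injOn Fin.tail (fun _ _ => mem_coe.2 (mem_univ _)) ?_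
        intro y hy z hz hyz
        simp only [coe_filter, mem_univ, true_and, Set.mem_ofPred_eq] at hy hz
        obtain ⟨k, hk⟩ := mem_blockP.1 hy
        obtain ⟨k', hk'⟩ := mem_blockP.1 hz
        obtain ⟨rfl, hval⟩ := eq_of_mul_add_val_eq (hk.trans hk'.symm)
        have hα := sub_right_inj.1 hval
        have htail : ∀ j : Fin m, y j.succ = z j.succ := fun j => congrFun hyz j
        simp only [alphaRS, Fin.sum_univ_succ, htail, add_left_inj] at hα
        have h0 := mul_right_cancel₀ (pow_ne_zero _ (natCast_succ_ne_zero hwv k)) hα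
        exact funext fun j => Fin.cases h0 htail j
    _ = v ^ m := by simp

theorem sum_card_inter_blockP_le {v m w : ℕ} [Fact v.Prime] (hwv : w < v) (i : Fin v)
    (Q : Finset (Fin (v * w))) :
    ∑ y : Fin (m + 1) → ZMod v, (Q ∩ blockP (alphaRS w y) i).card ≤ Q.card * v ^ m := by
  simp only [← filter_mem_eq_inter, card_filter]
  rw [sum_comm]
  refine (sum_le_card_nsmul _ _ (v ^ m) fun x _ => ?_).trans (smul_eq_mul _ _).le
  rw [← card_filter]
  exact card_filter_mem_blockP_le hwv i x

theorem sum_choose_card_inter_blockP_le {v ℓ w : ℕ} [Fact v.Prime] (hwv : w < v) (i : Fin v)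
    (Q : Finset (Fin (v * w))) :
    ∑ y : Fin ℓ → ZMod v, (Q ∩ blockP (alphaRS w y) i).card.choose ℓ ≤ Q.card ^ ℓ := by
  have hchoose : ∀ B : Finset (Fin (v * w)), (Q ∩ B).card.choose ℓ =
      ∑ S ∈ Q.powersetCard ℓ, if S ⊆ B then 1 else 0 := fun B => by
    rw [← card_powersetCard, ← card_filter]
    congr 1
    ext S
    simp only [mem_powersetCard, mem_filter, subset_inter_iff]
    tauto
  simp only [hchoose]
  rw [sum_comm]
  calc _ ≤ (Q.powersetCard ℓ).card • 1 := by
        refine sum_le_card_nsmul _ _ _ fun S hS => ?_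
        rw [← card_filter]
        exact card_filter_subset_blockP_le_one hwv i (mem_powersetCard.1 hS).2
    _ ≤ Q.card ^ ℓ := by
        rw [card_powersetCard, smul_eq_mul, mul_one]
        exact Nat.choose_le_pow _ _

theorem card_blockP_le {v w : ℕ} (α : Fin w → ZMod v) (i : Fin v) : (blockP α i).card ≤ w :=
  card_image_le.trans (by simp)

theorem two_pow_le_mul_add_choose {ℓ w n : ℕ} (hn : n ≤ w) (hpos : 0 < n) :
    2 ^ n ≤ 2 ^ ℓ * n + 2 ^ w * n.choose ℓ := by
  rcases le_total n ℓ with h | h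
  · calc 2 ^ n ≤ 2 ^ ℓ * n := (Nat.pow_le_pow_right two_pos h).trans (Nat.le_mul_of_pos_right _ hpos)
      _ ≤ _ := Nat.le_add_right _ _
  · calc 2 ^ n ≤ 2 ^ w * n.choose ℓ := (Nat.pow_le_pow_right two_pos hn).trans
          (Nat.le_mul_of_pos_right _ (Nat.choose_pos h))
      _ ≤ _ := Nat.le_add_left _ _

theorem statement12 (v : ℕ) [NeZero v] (ℓ w q : ℕ) (hv : v.Prime)
    (hℓ3 : 3 ≤ ℓ) (hℓw : 2 * ℓ ≤ w) (hwv : w < v) (hq1 : 1 ≤ q) (hqv : q ≤ v)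
    (Q : Finset (Fin (v * w))) (hQ : Q.card ≤ q) (j : Fin v) :
    (∑ y : Fin ℓ → ZMod v,
        (if (Q ∩ blockP (alphaRS w y) j).Nonempty
          then (2:ℝ) ^ ((Q ∩ blockP (alphaRS w y) j).card) else 0)) / (v:ℝ)^ℓ ≤
      ((2:ℝ)^ℓ + (2:ℝ)^w * ((q:ℝ)/v)^(ℓ-1)) * q / v := by
  have : Fact v.Prime := ⟨hv⟩
  obtain ⟨m, rfl⟩ : ∃ m, ℓ = m + 1 := ⟨ℓ - 1, by omega⟩
  have hsum : ∑ y : Fin (m + 1) → ZMod v,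
      (if (Q ∩ blockP (alphaRS w y) j).Nonempty
        then 2 ^ (Q ∩ blockP (alphaRS w y) j).card else 0) ≤
      2 ^ (m + 1) * (q * v ^ m) + 2 ^ w * q ^ (m + 1) := by
    calc _ ≤ ∑ y : Fin (m + 1) → ZMod v, (2 ^ (m + 1) * (Q ∩ blockP (alphaRS w y) j).card +
            2 ^ w * (Q ∩ blockP (alphaRS w y) j).card.choose (m + 1)) := by
          refine sum_le_sum fun y _ => ?_
          split_ifs with h
          · exact two_pow_le_mul_add_choose
              ((card_le_card inter_subset_right).trans (card_blockP_le _ _)) h.card_pos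
          · exact Nat.zero_le _
      _ ≤ _ := by
          rw [sum_add_distrib, ← mul_sum, ← mul_sum]
          gcongr
          · exact (sum_card_inter_blockP_le hwv j Q).trans (Nat.mul_le_mul_right _ hQ)
          · exact (sum_choose_card_inter_blockP_le hwv j Q).trans (Nat.pow_le_pow_left hQ _)
  have hsumR := (Nat.cast_le (α := ℝ)).2 hsum
  push_cast at hsumR
  have hv0 : (0 : ℝ) < v := Nat.cast_pos.2 hv.pos
  calc _ ≤ ((2 : ℝ) ^ (m + 1) * (q * v ^ m) + 2 ^ w * q ^ (m + 1)) / (v : ℝ) ^ (m + 1) := by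
        gcongr
    _ = _ := by
        rw [Nat.add_sub_cancel]
        rw [div_pow]
        field_simp
        ring
end
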